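/- Let c = min{n ∈ ℕ : a_n > 0}. Then for each fixed x ≥ 0, lim_{θ→0⁺} C(θ t(x)^α)/C(θ) = t(x)^{cα}, where t(x) = 1 - e^{-(β/γ)(e^{γx}-1)}. That is, the limiting distribution of GGPS(α,β,γ,θ) as θ→0⁺ is GG(cα, β, γ). -/

import Mathlib

open Real Filter Set

/-- A convergent power series whose coefficients below `c` vanish factors
through `y ^ c`. -/
lemma tsum_mul_pow_eq_pow_mul_tsum {a : ℕ → ℝ} {c : ℕ} (hlt : ∀ n < c, a n = 0) {y : ℝ}
    (hy : Summable fun n : ℕ => a n * y ^ n) :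
    ∑' n : ℕ, a n * y ^ n = y ^ c * ∑' n : ℕ, a (n + c) * y ^ n := by
  rw [← hy.sum_add_tsum_nat_add c, Finset.sum_eq_zero, zero_add, ← tsum_mul_left]
  · exact tsum_congr fun n => by ring
  · intro n hn
    rw [hlt n (Finset.mem_range.mp hn), zero_mul]

lemma tendsto_tsum_mul_pow_nhdsGE_zero {b : ℕ → ℝ} {r : ℝ} (hb : ∀ n, 0 ≤ b n) (hr : 0 < r)
    (hsum : Summable fun n : ℕ => b n * r ^ n) :
    Tendsto (fun y : ℝ => ∑' n : ℕ, b n * y ^ n) (nhdsWithin 0 (Ici 0)) (nhds (b 0)) := by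
  have h0 : ∑' n : ℕ, b n * (0 : ℝ) ^ n = b 0 := by
    rw [tsum_eq_single 0 fun n hn => by simp [hn]]
    simp
  rw [← h0]
  refine tendsto_tsum_of_dominated_convergence hsum (fun n => ?_) ?_
  · have h : Continuous fun y : ℝ => b n * y ^ n := by fun_prop
    exact (h.tendsto 0).mono_left nhdsWithin_le_nhds
  · filter_upwards [self_mem_nhdsWithin, nhdsWithin_le_nhds (Iio_mem_nhds hr)] with y hy hyr n
    have hy0 : (0 : ℝ) ≤ y := hy
    rw [Real.norm_of_nonneg (mul_nonneg (hb n) (pow_nonneg hy0 n))]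
    exact mul_le_mul_of_nonneg_left (pow_le_pow_left₀ hy0 (le_of_lt hyr) n) (hb n)

/-- A ratio `C (θ u) / C θ` of power series with nonnegative coefficients and lowest term of
degree `c` tends to `u ^ c` as `θ` decreases to `0`. -/
lemma tendsto_tsum_mul_pow_div_tsum {a : ℕ → ℝ} {c : ℕ} {s u : ℝ} (hs : 0 < s)
    (ha : ∀ n, 0 ≤ a n) (hac : 0 < a c) (hlt : ∀ n < c, a n = 0)
    (hsum : ∀ θ ∈ Ioo (0 : ℝ) s, Summable fun n : ℕ => a n * θ ^ n) (hu0 : 0 ≤ u) (hu1 : u ≤ 1) :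
    Tendsto (fun θ : ℝ => (∑' n : ℕ, a n * (θ * u) ^ n) / ∑' n : ℕ, a n * θ ^ n)
      (nhdsWithin 0 (Ioi 0)) (nhds (u ^ c)) := by
  have hr : 0 < s / 2 := by positivity
  have hshift : Summable fun n : ℕ => a (n + c) * (s / 2) ^ n := by
    have h := (summable_nat_add_iff c).mpr (hsum (s / 2) ⟨hr, by linarith⟩)
    refine (h.mul_right ((s / 2) ^ c)⁻¹).congr fun n => ?_
    rw [pow_add]
    field_simp
  have hG := tendsto_tsum_mul_pow_nhdsGE_zero (fun n => ha (n + c)) hr hshift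
  rw [zero_add] at hG
  have hden := hG.mono_left (nhdsWithin_mono 0 Ioi_subset_Ici_self)
  have hmul : Tendsto (fun θ : ℝ => θ * u) (nhdsWithin 0 (Ioi 0)) (nhdsWithin 0 (Ici 0)) := by
    refine tendsto_nhdsWithin_iff.mpr ⟨?_, ?_⟩
    · have h : Continuous fun θ : ℝ => θ * u := by fun_prop
      simpa using (h.tendsto 0).mono_left (nhdsWithin_le_nhds (s := Ioi 0))
    · filter_upwards [self_mem_nhdsWithin] with θ hθ
      exact mul_nonneg (le_of_lt hθ) hu0
  have hlim := ((hG.comp hmul).div hden hac.ne').const_mul (u ^ c)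
  rw [div_self hac.ne', mul_one] at hlim
  refine hlim.congr' ?_
  filter_upwards [self_mem_nhdsWithin, nhdsWithin_le_nhds (Iio_mem_nhds hs)] with θ hθ hθs
  have hθ0 : (0 : ℝ) < θ := hθ
  have hsθ := hsum θ ⟨hθ0, hθs⟩
  have hsu : Summable fun n : ℕ => a n * (θ * u) ^ n := by
    refine hsθ.of_nonneg_of_le (fun n => mul_nonneg (ha n) (by positivity)) fun n => ?_
    exact mul_le_mul_of_nonneg_left
      (pow_le_pow_left₀ (by positivity) (mul_le_of_le_one_right hθ0.le hu1) n) (ha n)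
  rw [tsum_mul_pow_eq_pow_mul_tsum hlt hsθ, tsum_mul_pow_eq_pow_mul_tsum hlt hsu, mul_pow,
    mul_assoc, mul_div_mul_left _ _ (pow_pos hθ0 c).ne', mul_div_assoc]
  rfl

theorem ggps_limit_theta_to_zero (α β γ s : ℝ) (a : ℕ → ℝ) (c : ℕ) (x : ℝ)
    (hα : 0 < α) (hβ : 0 < β) (hγ : 0 < γ) (hs : 0 < s) (hx : 0 ≤ x)
    (hapos : ∀ n, 0 ≤ a n) (hc1 : 1 ≤ c) (hac : 0 < a c) (hlt : ∀ n < c, a n = 0)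
    (hsum : ∀ θ ∈ Set.Ioo (0:ℝ) s, Summable (fun n : ℕ => a n * θ ^ n)) :
    let t : ℝ := 1 - Real.exp (-(β / γ) * (Real.exp (γ * x) - 1))
    Tendsto (fun θ : ℝ => (∑' n : ℕ, a n * (θ * t ^ α) ^ n) / (∑' n : ℕ, a n * θ ^ n))
      (nhdsWithin 0 (Set.Ioi 0)) (nhds (t ^ ((c : ℝ) * α))) := by
  intro t
  have ht0 : 0 ≤ t := by
    have hexp : 1 ≤ Real.exp (γ * x) := Real.one_le_exp (by positivity)
    have hprod : 0 ≤ β / γ * (Real.exp (γ * x) - 1) :=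
      mul_nonneg (by positivity) (sub_nonneg.mpr hexp)
    exact sub_nonneg.mpr (Real.exp_le_one_iff.mpr (by linarith))
  have ht1 : t ≤ 1 := sub_le_self _ (Real.exp_pos _).le
  rw [mul_comm (c : ℝ) α, Real.rpow_mul ht0, Real.rpow_natCast]
  exact tendsto_tsum_mul_pow_div_tsum hs hapos hac hlt hsum (Real.rpow_nonneg ht0 α)
    (Real.rpow_le_one ht0 ht1 hα.le)
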